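/- A formula is a theorem of K4C_n if and only if it is valid in all transitive frames with circumference at most n and no strictly ascending chains, if and only if it is valid in all finite transitive frames with circumference at most n. -/

import Mathlib

/-- Modal formulas: variables, ⊤, ¬, ∧, □. -/
inductive Fml : Type
  | var : ℕ → Fml
  | top : Fml
  | neg : Fml → Fml
  | and : Fml → Fml → Fml
  | box : Fml → Fml
deriving DecidableEq

namespace Fml
/-- Material implication, defined from ¬ and ∧. -/
def imp (φ ψ : Fml) : Fml := .neg (.and φ (.neg ψ))
/-- Disjunction. -/
def or (φ ψ : Fml) : Fml := .neg (.and (.neg φ) (.neg ψ))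
/-- ◇φ := ¬□¬φ. -/
def dia (φ : Fml) : Fml := .neg (.box (.neg φ))
/-- □*φ := φ ∧ □φ. -/
def boxs (φ : Fml) : Fml := .and φ (.box φ)
/-- ◇*φ := φ ∨ ◇φ. -/
def dias (φ : Fml) : Fml := Fml.or φ (dia φ)
end Fml

/-- Kripke satisfaction. -/
def sat {W : Type} (R : W → W → Prop) (V : ℕ → Set W) : W → Fml → Prop
  | x, .var p => x ∈ V p
  | _, .top => True
  | x, .neg φ => ¬ sat R V x φ
  | x, .and φ ψ => sat R V x φ ∧ sat R V x ψ
  | x, .box φ => ∀ y, R x y → sat R V y φ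

/-- P_n(φ0; φ1,...,φn): P_0(φ0) = ◇φ0, P_n(φ0,φ1,...,φn) = ◇(φ1 ∧ P_{n-1}(φ0,φ2,...,φn)). -/
def Pfml (φ0 : Fml) : List Fml → Fml
  | [] => φ0.dia
  | ψ :: rest => (Fml.and ψ (Pfml φ0 rest)).dia

/-- Conjunction of ¬(φ ∧ ψ) for ψ in the list. -/
def conjNeg (φ : Fml) : List Fml → Fml
  | [] => .top
  | ψ :: rest => .and (.neg (.and φ ψ)) (conjNeg φ rest)

/-- D_n: pairwise disjointness conjunction ⋀_{i<j} ¬(φ_i ∧ φ_j). -/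
def Dfml : List Fml → Fml
  | [] => .top
  | φ :: rest => .and (conjNeg φ rest) (Dfml rest)

/-- The scheme C_n instance on φ0,φ1,...,φn (φs = [φ1,...,φn]). -/
def Cfml (φ0 : Fml) (φs : List Fml) : Fml :=
  ((Dfml (φ0 :: φs)).boxs).imp ((φ0.dia).imp ((Fml.and φ0 (Fml.neg (Pfml φ0 φs))).dia))

/-- The scheme C_n* instance: as C_n but with ◇* in the consequent. -/
def CfmlStar (φ0 : Fml) (φs : List Fml) : Fml :=
  ((Dfml (φ0 :: φs)).boxs).imp ((φ0.dia).imp ((Fml.and φ0 (Fml.neg (Pfml φ0 φs))).dias))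

/-- An ascending R-chain. -/
def AscChain {W : Type} (R : W → W → Prop) (x : ℕ → W) : Prop := ∀ m, R (x m) (x (m+1))

/-- A strictly ascending R-chain. -/
def StrictAscChain {W : Type} (R : W → W → Prop) (x : ℕ → W) : Prop :=
  AscChain R x ∧ ∀ m, ¬ R (x (m+1)) (x m)

/-- The R-cluster of x. -/
def cluster {W : Type} (R : W → W → Prop) (x : W) : Set W := {y | x = y ∨ (R x y ∧ R y x)}

/-- The frame has a cycle of length k (k ≥ 1): k distinct points x_0 R x_1 R ... R x_{k-1} R x_0. -/
def HasCycle {W : Type} (R : W → W → Prop) (k : ℕ) : Prop :=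
  1 ≤ k ∧ ∃ x : ℕ → W, (∀ i j, i < k → j < k → x i = x j → i = j) ∧
    ∀ i < k, R (x i) (x ((i+1) % k))

/-- Circumference at most n: every cycle has length ≤ n. -/
def CircumLE {W : Type} (R : W → W → Prop) (n : ℕ) : Prop := ∀ k, HasCycle R k → k ≤ n

/-- The frame (W,R) validates the scheme C_n. -/
def ValidatesCn {W : Type} (R : W → W → Prop) (n : ℕ) : Prop :=
  ∀ (V : ℕ → Set W) (x : W) (φ0 : Fml) (φs : List Fml), φs.length = n →
    sat R V x (Cfml φ0 φs)

/-- A Boolean valuation on formulas (box-formulas and variables as atoms). -/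
def BoolEval (w : Fml → Bool) : Prop :=
  w .top = true ∧ (∀ φ, w (.neg φ) = !w φ) ∧ (∀ φ ψ, w (.and φ ψ) = (w φ && w ψ))

/-- Propositional tautologies. -/
def Tautology (φ : Fml) : Prop := ∀ w, BoolEval w → w φ = true

/-- Theorems of the smallest normal modal logic containing the axiom set Ax. -/
inductive Prov (Ax : Set Fml) : Fml → Prop
  | taut {φ} : Tautology φ → Prov Ax φ
  | kax (φ ψ) : Prov Ax ((Fml.box (φ.imp ψ)).imp ((Fml.box φ).imp (Fml.box ψ)))
  | ax {φ} : φ ∈ Ax → Prov Ax φ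
  | mp {φ ψ} : Prov Ax (φ.imp ψ) → Prov Ax φ → Prov Ax ψ
  | nec {φ} : Prov Ax φ → Prov Ax (.box φ)

/-- All instances of the transitivity scheme 4. -/
def Ax4 : Set Fml := {χ | ∃ φ, χ = (Fml.box φ).imp (Fml.box (Fml.box φ))}

/-- Axioms of K4C_n: scheme 4 together with all instances of scheme C_n. -/
def AxK4C (n : ℕ) : Set Fml :=
  Ax4 ∪ {χ | ∃ (φ0 : Fml) (φs : List Fml), φs.length = n ∧ χ = Cfml φ0 φs}

/-! ### Semantics of the derived connectives -/

section Semantics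

variable {W : Type} {R : W → W → Prop} {V : ℕ → Set W}

theorem sat_imp {x : W} {φ ψ : Fml} :
    sat R V x (φ.imp ψ) ↔ (sat R V x φ → sat R V x ψ) := by
  simp [Fml.imp, sat]

theorem sat_dia {x : W} {φ : Fml} :
    sat R V x φ.dia ↔ ∃ y, R x y ∧ sat R V y φ := by
  simp [Fml.dia, sat]

theorem sat_conjNeg {x : W} {φ : Fml} {l : List Fml} :
    sat R V x (conjNeg φ l) ↔ ∀ ψ ∈ l, ¬ (sat R V x φ ∧ sat R V x ψ) := by
  induction l with
  | nil => simp [conjNeg, sat]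
  | cons a l ih => simp [conjNeg, sat, ih]

theorem sat_Dfml {x : W} {l : List Fml} :
    sat R V x (Dfml l) ↔ l.Pairwise fun φ ψ => ¬ (sat R V x φ ∧ sat R V x ψ) := by
  induction l with
  | nil => simp [Dfml, sat]
  | cons a l ih => rw [List.pairwise_cons, ← ih, ← sat_conjNeg]; rfl

theorem sat_Cfml {x : W} {φ₀ : Fml} {φs : List Fml} :
    sat R V x (Cfml φ₀ φs) ↔
      (sat R V x (Dfml (φ₀ :: φs)) → (∀ y, R x y → sat R V y (Dfml (φ₀ :: φs))) →
        (∃ y, R x y ∧ sat R V y φ₀) →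
          ∃ y, R x y ∧ sat R V y φ₀ ∧ ¬ sat R V y (Pfml φ₀ φs)) := by
  simp only [Cfml, sat_imp, sat_dia, Fml.boxs, sat, and_imp]

/-- A point satisfying `Pfml φ₀ φs` starts a path through the `φs` that ends in `φ₀`. -/
theorem exists_path_of_sat_Pfml (hR : Transitive R) {φ₀ : Fml} :
    ∀ {φs : List Fml} {y : W}, sat R V y (Pfml φ₀ φs) →
      ∃ (l : List W) (z : W), List.Forall₂ (fun w ψ => sat R V w ψ) l φs ∧
        (∀ w ∈ l, R y w ∧ R w z) ∧ R y z ∧ sat R V z φ₀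
  | [], y, h => by
    obtain ⟨z, hz, hs⟩ := sat_dia.1 h
    exact ⟨[], z, .nil, by simp, hz, hs⟩
  | ψ :: φs, y, h => by
    obtain ⟨w, hw, hψ, hP⟩ := sat_dia.1 h
    obtain ⟨l, z, hl, hp, hz, hs⟩ := exists_path_of_sat_Pfml hR hP
    refine ⟨w :: l, z, .cons hψ hl, ?_, hR hw hz, hs⟩
    simp only [List.mem_cons, forall_eq_or_imp]
    exact ⟨⟨hw, hz⟩, fun u hu => ⟨hR hw (hp u hu).1, (hp u hu).2⟩⟩

/-- If every point of `Y` sees, inside `Y`, a point satisfying each of the formulas involved, then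
`Pfml` holds throughout `Y`. -/
theorem sat_Pfml_of_recurrent {Y : Set W} {φ₀ : Fml} {φs : List Fml}
    (h : ∀ ψ ∈ φ₀ :: φs, ∀ y ∈ Y, ∃ z ∈ Y, R y z ∧ sat R V z ψ) :
    ∀ y ∈ Y, sat R V y (Pfml φ₀ φs) := by
  induction φs with
  | nil =>
    intro y hy
    obtain ⟨z, -, hz⟩ := h φ₀ (by simp) y hy
    exact sat_dia.2 ⟨z, hz⟩
  | cons ψ φs ih =>
    intro y hy
    obtain ⟨z, hzY, hz, hs⟩ := h ψ (by simp) y hy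
    refine sat_dia.2 ⟨z, hz, hs, ih (fun θ hθ => h θ ?_) z hzY⟩
    simp only [List.mem_cons] at hθ ⊢
    tauto

/-- Points satisfying pairwise incompatible formulas are distinct. -/
theorem nodup_of_forall₂_sat {l : List W} {φs : List Fml}
    (h : List.Forall₂ (fun w ψ => sat R V w ψ) l φs)
    (hD : ∀ w ∈ l, sat R V w (Dfml φs)) : l.Nodup := by
  induction h with
  | nil => simp
  | @cons w ψ l φs hw hl ih =>
    refine List.nodup_cons.2 ⟨fun hmem => ?_, ih fun u hu => (hD u (by simp [hu])).2⟩
    have hdis := sat_conjNeg.1 (hD w (by simp)).1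
    obtain ⟨θ, hθ, hs⟩ : ∃ θ ∈ φs, sat R V w θ := by
      clear hdis ih hD
      induction hl with
      | nil => simp at hmem
      | @cons u θ l φs hu _ ih =>
        rcases List.mem_cons.1 hmem with rfl | hmem
        · exact ⟨θ, by simp, hu⟩
        · obtain ⟨θ', hθ', hs⟩ := ih hmem
          exact ⟨θ', by simp [hθ'], hs⟩
    exact hdis θ hθ ⟨hw, hs⟩

end Semantics

/-! ### Cycles -/

section Cycles

variable {W : Type} {R : W → W → Prop}

theorem CircumLE.length_le {n : ℕ} (hc : CircumLE R n) {l : List W} (hl : l.Nodup)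
    (h : ∀ x ∈ l, ∀ y ∈ l, R x y) : l.length ≤ n := by
  rcases l.eq_nil_or_concat with rfl | ⟨l', a, -⟩
  · simp
  rcases Nat.eq_zero_or_pos l.length with h0 | hpos
  · omega
  refine hc _ ⟨hpos, fun i => l.getD i a, fun i j hi hj hij => ?_, fun i hi => ?_⟩
  · simp only [List.getD_eq_getElem _ _ hi, List.getD_eq_getElem _ _ hj] at hij
    exact (List.Nodup.getElem_inj_iff hl).1 hij
  · have hj := Nat.mod_lt (i + 1) hpos
    simp only [List.getD_eq_getElem _ _ hi, List.getD_eq_getElem _ _ hj]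
    exact h _ (List.getElem_mem _) _ (List.getElem_mem _)

theorem cycle_related (hR : Transitive R) {k : ℕ} {x : ℕ → W}
    (h : ∀ i < k, R (x i) (x ((i + 1) % k))) {i j : ℕ} (hi : i < k) (hj : j < k) :
    R (x i) (x j) := by
  have key : ∀ d, R (x i) (x ((i + d + 1) % k)) := by
    intro d
    induction d with
    | zero => exact h i hi
    | succ d ih =>
      have := h _ (Nat.mod_lt (i + d + 1) (by omega))
      rw [Nat.mod_add_mod] at this
      exact hR ih this
  have hd := key (j + k - i - 1)
  rwa [show i + (j + k - i - 1) + 1 = j + k by omega, Nat.add_mod_right,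
    Nat.mod_eq_of_lt hj] at hd

theorem cluster_eq (hR : Transitive R) {x y : W} (hxy : R x y) (hyx : R y x) :
    cluster R x = cluster R y := by
  ext z
  constructor
  · rintro (rfl | ⟨h₁, h₂⟩)
    · exact Or.inr ⟨hyx, hxy⟩
    · exact Or.inr ⟨hR hyx h₁, hR h₂ hxy⟩
  · rintro (rfl | ⟨h₁, h₂⟩)
    · exact Or.inr ⟨hxy, hyx⟩
    · exact Or.inr ⟨hR hxy h₁, hR h₂ hyx⟩

theorem StrictAscChain.infinite (hR : Transitive R) {c : ℕ → W} (hc : StrictAscChain R c) :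
    Infinite W := by
  have hlt : ∀ i d, R (c i) (c (i + d + 1)) := by
    intro i d
    induction d with
    | zero => exact hc.1 i
    | succ d ih => exact hR ih (hc.1 _)
  refine Infinite.of_injective c (.of_lt_imp_ne fun i j hij heq => ?_)
  apply hc.2 i
  obtain ⟨d, rfl⟩ := Nat.exists_eq_add_of_lt hij
  rcases d with _ | d
  · have h := hlt i 0
    simp only [Nat.add_zero] at heq h
    rw [← heq] at h ⊢
    exact h
  · have h := hlt (i + 1) d
    rw [show i + 1 + d + 1 = i + (d + 1) + 1 by omega, ← heq] at h
    exact h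

end Cycles

/-! ### Soundness -/

theorem tautology_sat {φ : Fml} (h : Tautology φ) {W : Type} (R : W → W → Prop)
    (V : ℕ → Set W) (x : W) : sat R V x φ := by
  classical
  have hb : ∀ ψ, ∃ b : Bool, b = true ↔ sat R V x ψ := fun ψ => ⟨decide _, decide_eq_true_iff⟩
  choose w hw using hb
  refine (hw φ).1 (h w ⟨(hw _).2 trivial, fun ψ => ?_, fun ψ θ => ?_⟩)
  · rw [Bool.eq_iff_iff, hw, Bool.not_eq_true', ← Bool.not_eq_true, hw, sat]
  · rw [Bool.eq_iff_iff, hw, Bool.and_eq_true, hw, hw, sat]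

theorem validatesCn_of_circumLE {W : Type} {R : W → W → Prop} {n : ℕ} (hR : Transitive R)
    (hc : CircumLE R n) (hs : ¬ ∃ c : ℕ → W, StrictAscChain R c) : ValidatesCn R n := by
  intro V x φ₀ φs hlen
  rw [sat_Cfml]
  rintro - hD ⟨y, hxy, hy⟩
  by_contra! hcon
  have hwf : WellFounded fun a b : W => R b a ∧ ¬ R a b := by
    refine wellFounded_iff_isEmpty_descending_chain.2 ⟨fun ⟨c, hc⟩ => hs ⟨c, ?_⟩⟩
    exact ⟨fun m => (hc m).1, fun m => (hc m).2⟩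
  obtain ⟨m, ⟨hxm, hm⟩, hmax⟩ := hwf.has_min {y | R x y ∧ sat R V y φ₀} ⟨y, hxy, hy⟩
  obtain ⟨l, z, hl, hp, hmz, hz⟩ := exists_path_of_sat_Pfml hR (hcon m hxm hm)
  have hzm : R z m := by
    by_contra hzm
    exact hmax z ⟨hR hxm hmz, hz⟩ ⟨hmz, hzm⟩
  have hin : ∀ w ∈ m :: l, R m w ∧ R w m := by
    simp only [List.mem_cons, forall_eq_or_imp]
    exact ⟨⟨hR hmz hzm, hR hmz hzm⟩, fun w hw => ⟨(hp w hw).1, hR (hp w hw).2 hzm⟩⟩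
  have hnd : (m :: l).Nodup := nodup_of_forall₂_sat (List.Forall₂.cons hm hl)
    fun w hw => hD w (hR hxm (hin w hw).1)
  have := hc.length_le hnd fun a ha b hb => hR (hin a ha).2 (hin b hb).1
  have hll := hl.length_eq
  simp only [List.length_cons] at this
  omega

theorem Prov.sat_of_validatesCn {n : ℕ} {φ : Fml} (h : Prov (AxK4C n) φ) {W : Type}
    {R : W → W → Prop} (hR : Transitive R) (hC : ValidatesCn R n) (V : ℕ → Set W) (x : W) :
    sat R V x φ := by
  induction h generalizing x with
  | taut h => exact tautology_sat h R V x
  | kax φ ψ =>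
    simp only [sat_imp, sat]
    exact fun h₁ h₂ y hy => h₁ y hy (h₂ y hy)
  | ax h =>
    rcases h with ⟨φ, rfl⟩ | ⟨φ₀, φs, hlen, rfl⟩
    · simp only [sat_imp, sat]
      exact fun h y hy z hz => h z (hR hy hz)
    · exact hC V x φ₀ φs hlen
  | mp _ _ ih₁ ih₂ => exact sat_imp.1 (ih₁ x) (ih₂ x)
  | nec _ ih => exact fun y _ => ih y

/-! ### The canonical model -/

theorem BoolEval.imp {w : Fml → Bool} (hw : BoolEval w) {φ ψ : Fml} :
    w (φ.imp ψ) = true ↔ (w φ = true → w ψ = true) := by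
  simp only [Fml.imp, hw.2.1, hw.2.2]
  cases w φ <;> cases w ψ <;> simp

theorem isClosed_boolEval : IsClosed {w : Fml → Bool | BoolEval w} := by
  simp only [BoolEval, Set.ofPred_and, Set.ofPred_forall]
  refine (isClosed_eq (by fun_prop) (by fun_prop)).inter (IsClosed.inter ?_ ?_)
  · exact isClosed_iInter fun φ =>
      isClosed_eq (by fun_prop) ((continuous_of_discreteTopology (f := Bool.not)).comp (continuous_apply φ))
  · refine isClosed_iInter fun φ => isClosed_iInter fun ψ => isClosed_eq (by fun_prop) ?_
    exact (continuous_of_discreteTopology (f := fun p : Bool × Bool => (p.1 && p.2))).comp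
      (Continuous.prodMk (continuous_apply (A := fun _ : Fml => Bool) φ) (continuous_apply ψ))

/-- Compactness of propositional consequence. -/
theorem exists_tautology_of_entails {Δ : Set Fml} {φ : Fml}
    (h : ∀ w, BoolEval w → (∀ ψ ∈ Δ, w ψ = true) → w φ = true) :
    ∃ l : List Fml, (∀ ψ ∈ l, ψ ∈ Δ) ∧ Tautology (l.foldr Fml.imp φ) := by
  have hK : IsCompact ({w : Fml → Bool | BoolEval w} ∩ {w | w φ = false}) :=
    (isClosed_boolEval.inter (isClosed_eq (by fun_prop) (by fun_prop))).isCompact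
  obtain ⟨u, hu⟩ := hK.elim_finite_subfamily_closed (fun ψ : Δ => {w : Fml → Bool | w ψ = true})
    (fun ψ => isClosed_eq (by fun_prop) (by fun_prop)) (by
      ext w
      simp only [Set.mem_inter_iff, Set.mem_ofPred_eq, Set.mem_iInter, Set.mem_empty_iff_false,
        iff_false, not_and]
      rintro ⟨hw, hφ⟩ hΔ
      have := h w hw fun ψ hψ => hΔ ⟨ψ, hψ⟩
      simp [hφ] at this)
  refine ⟨u.toList.map Subtype.val, by simp +contextual, fun w hw => ?_⟩
  have key : ∀ l : List Fml, ((∀ ψ ∈ l, w ψ = true) → w φ = true) →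
      w (l.foldr Fml.imp φ) = true := by
    intro l
    induction l with
    | nil => simp
    | cons a l ih =>
      intro hl
      refine hw.imp.2 fun ha => ih fun hl' => hl ?_
      simpa [ha] using hl'
  refine key _ fun hl => ?_
  by_contra hφ
  have : w ∈ (∅ : Set (Fml → Bool)) := by
    rw [← hu]
    refine ⟨⟨hw, by simpa using hφ⟩, ?_⟩
    simp only [Set.mem_iInter, Set.mem_ofPred_eq]
    exact fun ψ hψ => hl ψ (List.mem_map.2 ⟨ψ, by simpa using hψ, rfl⟩)
  exact this

/-- Points of the canonical model: Boolean valuations that satisfy every theorem. -/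
def CanonicalPoint (Ax : Set Fml) : Type :=
  {w : Fml → Bool // BoolEval w ∧ ∀ ψ, Prov Ax ψ → w ψ = true}

/-- The canonical accessibility relation. -/
def canonicalRel (Ax : Set Fml) (w v : CanonicalPoint Ax) : Prop :=
  ∀ ψ, w.1 (.box ψ) = true → v.1 ψ = true

/-- The canonical valuation of the variables. -/
def canonicalVal (Ax : Set Fml) (p : ℕ) : Set (CanonicalPoint Ax) :=
  {w | w.1 (.var p) = true}

theorem exists_canonicalPoint_of_not_prov {Ax : Set Fml} {φ : Fml} (h : ¬ Prov Ax φ) :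
    ∃ w : CanonicalPoint Ax, w.1 φ = false := by
  by_contra! hcon
  obtain ⟨l, hl, ht⟩ := exists_tautology_of_entails (Δ := {ψ | Prov Ax ψ}) (φ := φ)
    fun w hw hΔ => by simpa using hcon ⟨w, hw, hΔ⟩
  apply h
  have key : Prov Ax (l.foldr Fml.imp φ) := .taut ht
  clear ht
  induction l with
  | nil => exact key
  | cons a l ih =>
    exact ih (fun ψ hψ => hl ψ (by simp [hψ])) (.mp key (hl a (by simp)))

theorem exists_canonicalRel_of_box_false {Ax : Set Fml} {w : CanonicalPoint Ax} {φ : Fml}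
    (h : w.1 (.box φ) = false) : ∃ v, canonicalRel Ax w v ∧ v.1 φ = false := by
  by_contra! hcon
  obtain ⟨l, hl, ht⟩ := exists_tautology_of_entails (Δ := {ψ | w.1 (.box ψ) = true}) (φ := φ)
    fun v hv hΔ => by
      simpa using hcon ⟨v, hv, fun ψ hψ => hΔ ψ (w.2.2 _ (.nec hψ))⟩ hΔ
  have key : w.1 (.box (l.foldr Fml.imp φ)) = true := w.2.2 _ (.nec (.taut ht))
  clear ht
  induction l with
  | nil => simp_all
  | cons a l ih =>
    refine ih (fun ψ hψ => hl ψ (by simp [hψ])) ?_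
    exact w.2.1.imp.1 (w.2.1.imp.1 (w.2.2 _ (.kax _ _)) key) (hl a (by simp))

theorem sat_canonical {Ax : Set Fml} (φ : Fml) (w : CanonicalPoint Ax) :
    sat (canonicalRel Ax) (canonicalVal Ax) w φ ↔ w.1 φ = true := by
  induction φ generalizing w with
  | var p => rfl
  | top => simp [sat, w.2.1.1]
  | neg φ ih => simp [sat, ih, w.2.1.2.1]
  | and φ ψ ih₁ ih₂ => simp [sat, ih₁, ih₂, w.2.1.2.2]
  | box φ ih =>
    simp only [sat, ih]
    refine ⟨fun h => ?_, fun h v hv => hv φ h⟩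
    by_contra hb
    obtain ⟨v, hv, hφ⟩ := exists_canonicalRel_of_box_false (Bool.eq_false_iff.2 hb)
    simp [h v hv] at hφ

theorem transitive_canonicalRel {Ax : Set Fml} (h : Ax4 ⊆ Ax) : Transitive (canonicalRel Ax) := by
  intro u v w huv hvw ψ hψ
  exact hvw ψ (huv _ (u.2.1.imp.1 (u.2.2 _ (.ax (h ⟨ψ, rfl⟩))) hψ))

/-! ### Filtration -/

namespace Fml

/-- The set of subformulas. -/
def subs : Fml → Finset Fml
  | var p => {var p}
  | top => {top}
  | neg φ => insert (neg φ) φ.subs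
  | and φ ψ => insert (and φ ψ) (φ.subs ∪ ψ.subs)
  | box φ => insert (box φ) φ.subs

theorem self_mem_subs (φ : Fml) : φ ∈ φ.subs := by
  cases φ <;> simp [subs]

theorem subs_subset_of_mem {φ ψ : Fml} (h : ψ ∈ φ.subs) : ψ.subs ⊆ φ.subs := by
  induction φ with
  | var p => simp only [subs, Finset.mem_singleton] at h; rw [h]
  | top => simp only [subs, Finset.mem_singleton] at h; rw [h]
  | neg φ ih =>
    rcases Finset.mem_insert.1 h with rfl | h
    · exact Finset.Subset.refl _
    · exact (ih h).trans (Finset.subset_insert _ _)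
  | and φ₁ φ₂ ih₁ ih₂ =>
    rcases Finset.mem_insert.1 h with rfl | h
    · exact Finset.Subset.refl _
    · refine Finset.Subset.trans ?_ (Finset.subset_insert _ _)
      rcases Finset.mem_union.1 h with h | h
      · exact (ih₁ h).trans Finset.subset_union_left
      · exact (ih₂ h).trans Finset.subset_union_right
  | box φ ih =>
    rcases Finset.mem_insert.1 h with rfl | h
    · exact Finset.Subset.refl _
    · exact (ih h).trans (Finset.subset_insert _ _)

end Fml

section Filtration

variable {W : Type} (R : W → W → Prop) (V : ℕ → Set W) (Φ : Finset Fml)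

open Classical in
/-- The `Φ`-type of a point. -/
noncomputable def fmlType (x : W) : Finset Fml := Φ.filter fun ψ => sat R V x ψ

/-- The points of the filtration: the realized `Φ`-types. -/
abbrev Filtr : Type := Set.range (fmlType R V Φ)

/-- The class of a point in the filtration. -/
noncomputable def toFiltr (x : W) : Filtr R V Φ := ⟨fmlType R V Φ x, x, rfl⟩

/-- The transitive filtration relation. -/
def filtrRel (a b : Filtr R V Φ) : Prop :=
  ∀ ψ, Fml.box ψ ∈ a.1 → Fml.box ψ ∈ b.1 ∧ ψ ∈ b.1

/-- The classes in `C` seen by `x`. -/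
def seenIn (C : Set (Filtr R V Φ)) (x : W) : Set (Filtr R V Φ) :=
  {a | a ∈ C ∧ ∃ y, R x y ∧ toFiltr R V Φ y = a}

variable {R V Φ}

theorem toFiltr_surjective : Function.Surjective (toFiltr R V Φ) := by
  rintro ⟨_, x, rfl⟩
  exact ⟨x, rfl⟩

theorem mem_toFiltr {x : W} {ψ : Fml} :
    ψ ∈ (toFiltr R V Φ x).1 ↔ ψ ∈ Φ ∧ sat R V x ψ := by
  simp [toFiltr, fmlType]

theorem finite_filtr : Finite (Filtr R V Φ) := by
  refine (Φ.powerset.finite_toSet.subset ?_).to_subtype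
  rintro _ ⟨x, rfl⟩
  classical
  exact Finset.mem_coe.2 (Finset.mem_powerset.2 (Finset.filter_subset _ _))

theorem transitive_filtrRel : Transitive (filtrRel R V Φ) :=
  fun _ _ _ hab hbc ψ hψ => hbc ψ (hab ψ hψ).1

theorem filtrRel_of_rel (hR : Transitive R) (hΦ : ∀ φ ∈ Φ, φ.subs ⊆ Φ) {x y : W} (h : R x y) :
    filtrRel R V Φ (toFiltr R V Φ x) (toFiltr R V Φ y) := by
  intro ψ hψ
  obtain ⟨hmem, hs⟩ := mem_toFiltr.1 hψ
  refine ⟨mem_toFiltr.2 ⟨hmem, fun z hz => hs z (hR h hz)⟩, mem_toFiltr.2 ⟨?_, hs y h⟩⟩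
  exact hΦ _ hmem (by simp [Fml.subs, Fml.self_mem_subs])

/-- Every class of the filtration is defined by a formula. -/
theorem exists_characteristic_formula (a : Filtr R V Φ) :
    ∃ χ : Fml, ∀ x, sat R V x χ ↔ toFiltr R V Φ x = a := by
  have key : ∀ Ψ : Finset Fml, ∃ χ : Fml, ∀ x, sat R V x χ ↔
      ∀ ψ ∈ Ψ, (sat R V x ψ ↔ ψ ∈ a.1) := by
    intro Ψ
    induction Ψ using Finset.induction_on with
    | empty => exact ⟨.top, by simp [sat]⟩
    | insert ψ Ψ _ ih =>
      obtain ⟨χ, hχ⟩ := ih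
      by_cases hψ : ψ ∈ a.1
      · exact ⟨.and ψ χ, fun x => by simp [sat, hχ, hψ]⟩
      · exact ⟨.and (.neg ψ) χ, fun x => by simp [sat, hχ, hψ]⟩
  obtain ⟨χ, hχ⟩ := key Φ
  refine ⟨χ, fun x => (hχ x).trans ?_⟩
  obtain ⟨y, rfl⟩ := toFiltr_surjective a
  constructor
  · intro h
    apply Subtype.ext
    ext ψ
    by_cases hψ : ψ ∈ Φ
    · rw [mem_toFiltr, and_iff_right hψ]
      exact h ψ hψ
    · simp [mem_toFiltr, hψ]
  · rintro h ψ hψ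
    rw [← h, mem_toFiltr, and_iff_right hψ]

theorem seenIn_anti (hR : Transitive R) {C : Set (Filtr R V Φ)} {x y : W} (h : R x y) :
    seenIn R V Φ C y ⊆ seenIn R V Φ C x := by
  rintro a ⟨ha, z, hz, rfl⟩
  exact ⟨ha, z, hR h hz, rfl⟩

/-- If the classes seen in `C` never decrease above `x` (within `C`), then the scheme `C_n` bounds
their number by `n`. -/
theorem ncard_seenIn_le {n : ℕ} (hR : Transitive R)
    (hC : ∀ (x : W) (φ₀ : Fml) (φs : List Fml), φs.length = n → sat R V x (Cfml φ₀ φs))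
    {C : Set (Filtr R V Φ)} {x : W}
    (hx : ∀ y, R x y → toFiltr R V Φ y ∈ C → seenIn R V Φ C y = seenIn R V Φ C x) :
    (seenIn R V Φ C x).ncard ≤ n := by
  have := finite_filtr (R := R) (V := V) (Φ := Φ)
  by_contra! hlt
  obtain ⟨s, hs, hcard⟩ := Set.exists_subset_card_eq (Nat.succ_le_of_lt hlt)
  have hsf : s.Finite := Set.toFinite s
  obtain ⟨l, hnd, hls⟩ : ∃ l : List (Filtr R V Φ), l.Nodup ∧ ∀ a, a ∈ l ↔ a ∈ s :=
    ⟨hsf.toFinset.toList, Finset.nodup_toList _, by simp⟩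
  have hlen : l.length = n + 1 := by
    classical
    rw [← List.toFinset_card_of_nodup hnd, ← Set.ncard_coe_finset, ← Nat.succ_eq_add_one, ← hcard]
    congr 1
    ext a
    simp [hls]
  choose χ hχ using fun a : Filtr R V Φ => exists_characteristic_formula a
  obtain _ | ⟨a₀, as⟩ := l
  · simp at hlen
  have hD : ∀ y, sat R V y (Dfml (χ a₀ :: as.map χ)) := by
    intro y
    rw [sat_Dfml, ← List.map_cons, List.pairwise_map]
    refine hnd.imp fun {a b} hab ⟨ha, hb⟩ => hab ?_
    rw [← (hχ _ _).1 ha, (hχ _ _).1 hb]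
  have hseen : ∀ a ∈ a₀ :: as, a ∈ seenIn R V Φ C x := fun a ha => hs ((hls a).1 ha)
  obtain ⟨ha₀, y₀, hy₀, hty₀⟩ := hseen a₀ (by simp)
  obtain ⟨y, hxy, hy, hP⟩ := sat_Cfml.1 (hC x (χ a₀) (as.map χ) (by simpa using hlen))
    (hD x) (fun y _ => hD y) ⟨y₀, hy₀, (hχ _ _).2 hty₀⟩
  refine hP (sat_Pfml_of_recurrent (Y := {y | R x y ∧ toFiltr R V Φ y ∈ C}) ?_ y
    ⟨hxy, by rw [(hχ _ _).1 hy]; exact ha₀⟩)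
  rw [← List.map_cons]
  intro ψ hψ y hy
  obtain ⟨a, ha, rfl⟩ := List.mem_map.1 hψ
  have hay := hseen a ha
  rw [← hx y hy.1 hy.2] at hay
  obtain ⟨haC, z, hz, rfl⟩ := hay
  exact ⟨z, ⟨hR hy.1 hz, haC⟩, hz, (hχ _ _).2 rfl⟩

/-- Every cluster of the filtration contains the class of a point which sees at most `n` classes
of that cluster. -/
theorem exists_ncard_seenIn_le {n : ℕ} (hR : Transitive R)
    (hC : ∀ (x : W) (φ₀ : Fml) (φs : List Fml), φs.length = n → sat R V x (Cfml φ₀ φs))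
    {C : Set (Filtr R V Φ)} (hne : C.Nonempty) :
    ∃ x, toFiltr R V Φ x ∈ C ∧ (seenIn R V Φ C x).ncard ≤ n := by
  have := finite_filtr (R := R) (V := V) (Φ := Φ)
  obtain ⟨a, ha⟩ := hne
  obtain ⟨x₀, rfl⟩ := toFiltr_surjective a
  obtain ⟨x, hx, hmin⟩ := (measure fun x => (seenIn R V Φ C x).ncard).wf.has_min
    {x | toFiltr R V Φ x ∈ C} ⟨x₀, ha⟩
  refine ⟨x, hx, ncard_seenIn_le hR hC fun y hxy hy => ?_⟩
  exact Set.eq_of_subset_of_ncard_le (seenIn_anti hR hxy) (not_lt.1 (hmin y hy)) (Set.toFinite _)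

/-- The filtration relation, thinned out inside each cluster to arrows into the set `S` chosen for
that cluster. -/
def thinRel (S : Set (Filtr R V Φ) → Set (Filtr R V Φ)) (a b : Filtr R V Φ) : Prop :=
  filtrRel R V Φ a b ∧ (filtrRel R V Φ b a → b ∈ S (cluster (filtrRel R V Φ) b))

theorem transitive_thinRel (S : Set (Filtr R V Φ) → Set (Filtr R V Φ)) :
    Transitive (thinRel S) := by
  intro a b c hab hbc
  exact ⟨transitive_filtrRel hab.1 hbc.1,
    fun hca => hbc.2 (transitive_filtrRel hca hab.1)⟩

theorem circumLE_thinRel {n : ℕ} {S : Set (Filtr R V Φ) → Set (Filtr R V Φ)}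
    (hS : ∀ a, (S (cluster (filtrRel R V Φ) a)).ncard ≤ n) : CircumLE (thinRel S) n := by
  have := finite_filtr (R := R) (V := V) (Φ := Φ)
  rintro k ⟨hk, x, hinj, hcyc⟩
  have hrel : ∀ i < k, ∀ j < k, thinRel S (x i) (x j) := fun i hi j hj =>
    cycle_related (transitive_thinRel S) hcyc hi hj
  have hmem : ∀ i < k, x i ∈ S (cluster (filtrRel R V Φ) (x 0)) := by
    intro i hi
    rw [cluster_eq transitive_filtrRel (hrel 0 hk i hi).1 (hrel i hi 0 hk).1]
    exact (hrel i hi i hi).2 (hrel i hi i hi).1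
  refine le_trans ?_ (hS (x 0))
  have himg : x '' Set.Iio k ⊆ S (cluster (filtrRel R V Φ) (x 0)) := by
    rintro _ ⟨i, hi, rfl⟩
    exact hmem i hi
  have hcard : (x '' Set.Iio k).ncard = k := by
    rw [Set.InjOn.ncard_image (s := Set.Iio k) fun i hi j hj h => hinj i j hi hj h, ← Finset.coe_Iio,
      Set.ncard_coe_finset, Nat.card_Iio]
  exact hcard.symm.le.trans (Set.ncard_le_ncard himg (Set.toFinite _))

/-- The thinned filtration preserves the truth of the formulas in `Φ`, provided the chosen sets are
those seen by some point of the cluster. -/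
theorem sat_thinRel (hR : Transitive R) (hΦ : ∀ φ ∈ Φ, φ.subs ⊆ Φ)
    {S : Set (Filtr R V Φ) → Set (Filtr R V Φ)}
    (hS : ∀ a, ∃ x, toFiltr R V Φ x ∈ cluster (filtrRel R V Φ) a ∧
      S (cluster (filtrRel R V Φ) a) = seenIn R V Φ (cluster (filtrRel R V Φ) a) x)
    (φ : Fml) (hφ : φ ∈ Φ) (a : Filtr R V Φ) :
    sat (thinRel S) (fun p => {b | Fml.var p ∈ b.1}) a φ ↔ φ ∈ a.1 := by
  induction φ generalizing a with
  | var p => rfl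
  | top =>
    obtain ⟨x, rfl⟩ := toFiltr_surjective a
    simp [sat, mem_toFiltr, hφ]
  | neg φ ih =>
    have h₁ : φ ∈ Φ := hΦ _ hφ (by simp [Fml.subs, Fml.self_mem_subs])
    simp only [sat, ih h₁]
    obtain ⟨x, rfl⟩ := toFiltr_surjective a
    simp [sat, mem_toFiltr, hφ, h₁]
  | and φ ψ ih₁ ih₂ =>
    have h₁ : φ ∈ Φ := hΦ _ hφ (by simp [Fml.subs, Fml.self_mem_subs])
    have h₂ : ψ ∈ Φ := hΦ _ hφ (by simp [Fml.subs, Fml.self_mem_subs])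
    simp only [sat, ih₁ h₁, ih₂ h₂]
    obtain ⟨x, rfl⟩ := toFiltr_surjective a
    simp [sat, mem_toFiltr, hφ, h₁, h₂]
  | box φ ih =>
    have h₁ : φ ∈ Φ := hΦ _ hφ (by simp [Fml.subs, Fml.self_mem_subs])
    simp only [sat, ih h₁]
    refine ⟨fun h => ?_, fun h b hb => (hb.1 φ h).2⟩
    obtain ⟨x, hx, hSx⟩ := hS a
    have hbox : Fml.box φ ∈ (toFiltr R V Φ x).1 := by
      refine mem_toFiltr.2 ⟨hφ, fun y hxy => ?_⟩
      have hrel := filtrRel_of_rel (V := V) hR hΦ hxy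
      have hay : filtrRel R V Φ a (toFiltr R V Φ y) := by
        rcases hx with rfl | hx
        · exact hrel
        · exact transitive_filtrRel hx.1 hrel
      refine (mem_toFiltr.1 (h (toFiltr R V Φ y) ⟨hay, fun hya => ?_⟩)).2
      rw [← cluster_eq transitive_filtrRel hay hya, hSx]
      exact ⟨Or.inr ⟨hay, hya⟩, y, hxy, rfl⟩
    rcases hx with rfl | hx
    · exact hbox
    · exact (hx.2 φ hbox).1

end Filtration

/-- A formula refuted in a transitive model of the scheme `C_n` is refuted in a finite transitive
frame of circumference at most `n`. -/
theorem exists_finite_countermodel {n : ℕ} {W : Type} {R : W → W → Prop} {V : ℕ → Set W}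
    (hR : Transitive R)
    (hC : ∀ (x : W) (φ₀ : Fml) (φs : List Fml), φs.length = n → sat R V x (Cfml φ₀ φs))
    {φ : Fml} {x : W} (hx : ¬ sat R V x φ) :
    ∃ (W' : Type) (R' : W' → W' → Prop), Finite W' ∧ Transitive R' ∧ CircumLE R' n ∧
      ∃ (V' : ℕ → Set W') (x' : W'), ¬ sat R' V' x' φ := by
  have hpt : ∀ C : Set (Filtr R V φ.subs), ∃ y, C.Nonempty →
      toFiltr R V φ.subs y ∈ C ∧ (seenIn R V φ.subs C y).ncard ≤ n := by
    intro C
    by_cases hne : C.Nonempty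
    · obtain ⟨y, hy⟩ := exists_ncard_seenIn_le hR hC hne
      exact ⟨y, fun _ => hy⟩
    · exact ⟨x, fun h => absurd h hne⟩
  choose f hf using hpt
  have hne : ∀ a, (cluster (filtrRel R V φ.subs) a).Nonempty := fun a => ⟨a, Or.inl rfl⟩
  refine ⟨Filtr R V φ.subs, thinRel fun C => seenIn R V φ.subs C (f C), finite_filtr,
    transitive_thinRel _, circumLE_thinRel fun a => (hf _ (hne a)).2,
    fun p => {b | Fml.var p ∈ b.1}, toFiltr R V φ.subs x, ?_⟩
  rw [sat_thinRel hR (fun _ => Fml.subs_subset_of_mem)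
    (fun a => ⟨f _, (hf _ (hne a)).1, rfl⟩) φ φ.self_mem_subs, mem_toFiltr]
  exact fun h => hx h.2

theorem prov_of_valid_finite {n : ℕ} {φ : Fml}
    (h : ∀ (W : Type) (R : W → W → Prop), Finite W → Transitive R → CircumLE R n →
      ∀ (V : ℕ → Set W) (x : W), sat R V x φ) : Prov (AxK4C n) φ := by
  by_contra hφ
  obtain ⟨w, hw⟩ := exists_canonicalPoint_of_not_prov hφ
  obtain ⟨W, R, hfin, hR, hcirc, V, x, hx⟩ := exists_finite_countermodel (n := n) (φ := φ) (x := w)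
    (R := canonicalRel (AxK4C n)) (V := canonicalVal (AxK4C n))
    (transitive_canonicalRel Set.subset_union_left)
    (fun x φ₀ φs hlen => (sat_canonical _ _).2 (x.2.2 _ (.ax (Or.inr ⟨φ₀, φs, hlen, rfl⟩))))
    (by rw [sat_canonical, hw]; simp)
  exact hx (h W R hfin hR hcirc V x)

/-- φ is a theorem of K4C_n iff it is valid in all transitive frames
with circumference ≤ n and no strictly ascending chains, iff it is valid in all
finite transitive frames with circumference ≤ n. -/
theorem stmt10 (n : ℕ) (φ : Fml) :
    (Prov (AxK4C n) φ ↔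
      ∀ (W : Type) (R : W → W → Prop), Transitive R → CircumLE R n →
        (¬ ∃ c : ℕ → W, StrictAscChain R c) → ∀ (V : ℕ → Set W) (x : W), sat R V x φ) ∧
    (Prov (AxK4C n) φ ↔
      ∀ (W : Type) (R : W → W → Prop), Finite W → Transitive R → CircumLE R n →
        ∀ (V : ℕ → Set W) (x : W), sat R V x φ) := by
  have sound : Prov (AxK4C n) φ → ∀ (W : Type) (R : W → W → Prop), Transitive R → CircumLE R n →
      (¬ ∃ c : ℕ → W, StrictAscChain R c) → ∀ (V : ℕ → Set W) (x : W), sat R V x φ :=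
    fun h W R hR hc hs => h.sat_of_validatesCn hR (validatesCn_of_circumLE hR hc hs)
  have noChain : ∀ (W : Type) (R : W → W → Prop), Finite W → Transitive R →
      ¬ ∃ c : ℕ → W, StrictAscChain R c :=
    fun W R hW hR ⟨c, hc⟩ => not_finite_iff_infinite.2 (hc.infinite hR) hW
  exact ⟨⟨sound, fun h => prov_of_valid_finite fun W R hW hR hc => h W R hR hc (noChain W R hW hR)⟩,
    ⟨fun h W R hW hR hc => sound h W R hR hc (noChain W R hW hR), prov_of_valid_finite⟩⟩
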